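/- Let f ∈ AC¹. Then n · sup_{x∈[−1,1]} |B_n(f,x) − f(x)| → 0 as n → ∞ along odd integers n if and only if f is linear, i.e., f(x) = (f(1) + f(−1))/2 + ((f(1) − f(−1))/2) x for all x ∈ [−1,1]. -/

import Mathlib

open Filter Set MeasureTheory

noncomputable section

/-- Equally spaced nodes `x_{k,n} = 2k/n - 1`. -/
def node (n k : ℕ) : ℝ := 2 * k / n - 1

/-- `x` is one of the nodes `x_{0,n}, …, x_{n,n}`. -/
def isNode (n : ℕ) (x : ℝ) : Prop := ∃ k ≤ n, x = node n k

/-- Denominator of Berrut's interpolant. -/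
def Dden (n : ℕ) (x : ℝ) : ℝ :=
  ∑ k ∈ Finset.range (n + 1), (-1 : ℝ) ^ k / (x - node n k)

/-- Numerator of Berrut's interpolant. -/
def Nnum (f : ℝ → ℝ) (n : ℕ) (x : ℝ) : ℝ :=
  ∑ k ∈ Finset.range (n + 1), (-1 : ℝ) ^ k * f (node n k) / (x - node n k)

open Classical in
/-- Berrut's barycentric interpolant. -/
def berrut (f : ℝ → ℝ) (n : ℕ) (x : ℝ) : ℝ :=
  if isNode n x then f x else Nnum f n x / Dden n x

/-- The odd bias function `O(f,x)`. -/
def Ofun (f : ℝ → ℝ) (x : ℝ) : ℝ :=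
  (f x - f 1) / (2 * (x - 1)) - (f x - f (-1)) / (2 * (x + 1))

/-- The even bias function `E(f,x)`. -/
def Efun (f : ℝ → ℝ) (x : ℝ) : ℝ :=
  (f 1 - f x) / (2 * (x - 1)) + (f (-1) - f x) / (2 * (x + 1))

/-- `f` is differentiable on `[-1,1]` with absolutely continuous derivative. -/
def AC1 (f : ℝ → ℝ) : Prop :=
  ∃ f' : ℝ → ℝ,
    (∀ x ∈ Set.Icc (-1 : ℝ) 1, HasDerivWithinAt f (f' x) (Set.Icc (-1 : ℝ) 1) x) ∧
    ∃ g : ℝ → ℝ, IntervalIntegrable g volume (-1) 1 ∧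
      ∀ x ∈ Set.Icc (-1 : ℝ) 1, f' x = f' (-1) + ∫ t in (-1 : ℝ)..x, g t

/-- `x` is regular for the sequence `n j`: eventually never a node. -/
def Regular (n : ℕ → ℕ) (x : ℝ) : Prop := ∃ j₀, ∀ j ≥ j₀, ¬ isNode (n j) x

/-- The function `A(x) = Σ (-1)^k (4k+2)/((2k+1)^2 - x)`. -/
def Afun (x : ℝ) : ℝ := ∑' k : ℕ, (-1 : ℝ) ^ k * (4 * k + 2) / ((2 * k + 1) ^ 2 - x)

/-- `ι_n(x) = ⌊n(x+1)/2⌋`. -/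
def iota (n : ℕ) (x : ℝ) : ℤ := ⌊(n : ℝ) * (x + 1) / 2⌋

/-- `ρ_n(x) = n(x - x_{ι_n(x),n}) - 1 = n(x+1) - 2 ι_n(x) - 1`. -/
def rho (n : ℕ) (x : ℝ) : ℝ := (n : ℝ) * (x + 1) - 2 * (iota n x : ℝ) - 1

open Classical in
/-- The de-biased numerator `Δ_n(f,x)`. -/
def Delta (f : ℝ → ℝ) (n : ℕ) (x : ℝ) : ℝ :=
  if isNode n x then 0 else
    (f (-1) - f x) / (2 * (x + 1)) + (-1 : ℝ) ^ n * (f 1 - f x) / (2 * (x - 1)) +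
      (1 / (n : ℝ)) * ∑ k ∈ Finset.Ioo 0 n, (-1 : ℝ) ^ k * (f (node n k) - f x) / (x - node n k)

end


noncomputable def AA (m : ℕ) (d : ℝ) : ℝ := ∑ i ∈ Finset.range m, (-1 : ℝ) ^ i / (d + i)

lemma AA_succ (m : ℕ) (d : ℝ) : AA (m+1) d = 1 / d - AA m (d+1) := by
  unfold AA
  rw [Finset.sum_range_succ', add_comm, sub_eq_add_neg, ← Finset.sum_neg_distrib]
  congr 1
  · simp
  · apply Finset.sum_congr rfl
    intro i _
    rw [pow_succ, Nat.cast_succ, show d + ((i:ℝ)+1) = d + 1 + i by ring]; ring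

lemma AA_bd (m : ℕ) : ∀ d : ℝ, 0 < d → 0 ≤ AA m d ∧ AA m d ≤ 1 / d := by
  induction m with
  | zero => intro d hd; simp [AA]; positivity
  | succ m ih =>
    intro d hd
    rw [AA_succ]
    obtain ⟨h1, h2⟩ := ih (d+1) (by linarith)
    have : 1 / (d+1) ≤ 1 / d := one_div_le_one_div_of_le hd (by linarith)
    constructor <;> linarith

lemma AA_lower (m : ℕ) (d : ℝ) (h0 : 0 < d) (h1 : d < 1) : 1 / 2 ≤ AA (m+1) d := by
  rw [AA_succ]
  obtain ⟨_, h2⟩ := AA_bd m (d+1) (by linarith)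
  have : 1 / d - 1 / (d+1) = 1 / (d * (d+1)) := by field_simp; ring
  have h3 : 1 / 2 ≤ 1 / (d * (d+1)) := one_div_le_one_div_of_le (by positivity) (by nlinarith)
  linarith

lemma sub_node (n k : ℕ) (hn : 0 < n) (x : ℝ) :
    x - node n k = (2 / n) * (n * (x + 1) / 2 - k) := by
  have : (n:ℝ) ≠ 0 := by positivity
  unfold node; field_simp; ring

lemma Dden_eq (n j : ℕ) (hn : 0 < n) (hj : j < n) (x d : ℝ) (hd : n * (x + 1) / 2 = j + d) :
    Dden n x = (-1) ^ j * ((n / 2) * (AA (j+1) d + AA (n - j) (1 - d))) := by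
  have hn' : (n:ℝ) ≠ 0 := by positivity
  unfold Dden
  have e : n + 1 = (j + 1) + (n - j) := by omega
  rw [e, Finset.sum_range_add, mul_add, mul_add]
  congr 1
  · rw [← Finset.sum_range_reflect]
    unfold AA
    rw [Finset.mul_sum, Finset.mul_sum]
    apply Finset.sum_congr rfl
    intro i hi
    have hi : i ≤ j := by simpa [Nat.lt_succ_iff] using hi
    rw [sub_node n _ hn, hd]
    obtain ⟨k, rfl⟩ := Nat.exists_eq_add_of_le hi
    have : i + k + 1 - 1 - i = k := by omega
    rw [this]
    have h2 : ((-1:ℝ))^(i+k) * (-1)^i = (-1)^k := by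
      rw [pow_add, mul_right_comm, ← mul_pow]; simp
    rw [← h2]
    push_cast
    rw [show (i:ℝ) + k + d - k = d + i by ring]
    rw [div_mul_eq_div_div]
    field_simp
  · unfold AA
    rw [Finset.mul_sum, Finset.mul_sum]
    apply Finset.sum_congr rfl
    intro i hi
    rw [sub_node n _ hn, hd]
    push_cast
    rw [show (j:ℝ) + d - (j + 1 + i) = -(1 - d + i) by ring, pow_add, pow_succ, div_mul_eq_div_div,
      div_neg]
    field_simp

lemma node_mem (n k : ℕ) (hk : k ≤ n) : node n k ∈ Set.Icc (-1:ℝ) 1 := by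
  unfold node
  have h1 : (0:ℝ) ≤ k / n := by positivity
  have h2 : (k:ℝ) / n ≤ 1 := div_le_one_of_le₀ (by exact_mod_cast hk) (by positivity)
  rw [mul_div_assoc]
  constructor <;> linarith

lemma exists_jd (n : ℕ) (hn : 0 < n) (x : ℝ) (hx : x ∈ Set.Icc (-1:ℝ) 1) (h : ¬ isNode n x) :
    ∃ (j : ℕ) (d : ℝ), j < n ∧ 0 < d ∧ d < 1 ∧ n * (x + 1) / 2 = j + d := by
  have hn' : (0:ℝ) < n := by positivity
  have hy : 0 ≤ n * (x+1)/2 := by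
    have : 0 ≤ x + 1 := by linarith [hx.1]
    positivity
  have key : ∀ k : ℕ, k ≤ n → n * (x+1)/2 ≠ k := by
    intro k hk he
    apply h
    refine ⟨k, hk, ?_⟩
    have := sub_node n k hn x
    rw [he] at this
    linarith [this, mul_zero (2 / (n:ℝ)), sub_self (k:ℝ), (by rw [this]; ring : x - node n k = 0)]
  have hyn : n * (x+1)/2 < n := by
    apply lt_of_le_of_ne _ (key n le_rfl)
    nlinarith [hx.2]
  have hjn : ⌊n * (x+1)/2⌋₊ < n := (Nat.floor_lt hy).2 hyn
  refine ⟨⌊n * (x+1)/2⌋₊, n * (x+1)/2 - ⌊n * (x+1)/2⌋₊, hjn, ?_, ?_, by ring⟩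
  · have := lt_of_le_of_ne (Nat.floor_le hy) (key _ hjn.le).symm
    linarith
  · linarith [Nat.lt_floor_add_one (n * (x+1)/2)]

lemma Dden_lower (n : ℕ) (hn : 0 < n) (x : ℝ) (hx : x ∈ Set.Icc (-1:ℝ) 1) (h : ¬ isNode n x) :
    (n:ℝ) / 2 ≤ |Dden n x| := by
  obtain ⟨j, d, hj, h0, h1, he⟩ := exists_jd n hn x hx h
  rw [Dden_eq n j hn hj x d he, abs_mul, abs_pow, abs_neg, abs_one, one_pow, one_mul]
  refine le_trans ?_ (le_abs_self _)
  have a1 := AA_lower j d h0 h1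
  have a2 := AA_lower (n - j - 1) (1 - d) (by linarith) (by linarith)
  rw [show n - j - 1 + 1 = n - j by omega] at a2
  have : (0:ℝ) < n := by positivity
  nlinarith

lemma Dden_upper (n p q : ℕ) (hn : Odd n) (hp : Odd p) (hq : Even q) (hpq : p < q) :
    ¬ isNode n (2 * p / q - 1) ∧ |Dden n (2 * p / q - 1)| ≤ n * q := by
  have hn0 : 0 < n := hn.pos
  have hq0 : 0 < q := by omega
  have hn' : (0:ℝ) < n := by positivity
  have hq' : (0:ℝ) < q := by positivity
  have hnode : ¬ isNode n (2 * p / q - 1) := by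
    rintro ⟨k, _, hk⟩
    unfold node at hk
    field_simp at hk
    have hk : 2 * (p:ℝ) * n = 2 * k * q := by linarith
    have h2 : p * n = k * q := by
      have : (p:ℝ) * n = k * q := by linarith
      exact_mod_cast this
    have h3 : Odd (p * n) := hp.mul hn
    rw [h2] at h3
    exact (Nat.not_even_iff_odd.2 h3) (hq.mul_left k)
  refine ⟨hnode, ?_⟩
  have hx : (2 * p / q - 1 : ℝ) ∈ Set.Icc (-1:ℝ) 1 := node_mem q p hpq.le
  obtain ⟨j, d, hj, h0, h1, he⟩ := exists_jd n hn0 _ hx hnode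
  have he' : (n:ℝ) * p = j * q + d * q := by field_simp at he; linarith
  have b1 : 1 ≤ d * q := by
    have : (j * q : ℝ) < n * p := by nlinarith
    have : j * q + 1 ≤ n * p := by exact_mod_cast this
    have : (j * q : ℝ) + 1 ≤ n * p := by exact_mod_cast this
    linarith
  have b2 : 1 ≤ (1 - d) * q := by
    have : (n * p : ℝ) < (j + 1) * q := by nlinarith
    have : n * p + 1 ≤ (j + 1) * q := by exact_mod_cast this
    have : (n * p : ℝ) + 1 ≤ (j + 1) * q := by exact_mod_cast this
    linarith
  rw [Dden_eq n j hn0 hj _ d he, abs_mul, abs_pow, abs_neg, abs_one, one_pow, one_mul]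
  obtain ⟨c1, c2⟩ := AA_bd (j+1) d h0
  obtain ⟨c3, c4⟩ := AA_bd (n-j) (1-d) (by linarith)
  have e1 : 1 / d ≤ q := by rw [div_le_iff₀ h0]; linarith
  have e2 : 1 / (1-d) ≤ q := by rw [div_le_iff₀ (by linarith)]; linarith
  rw [abs_of_nonneg (by positivity)]
  nlinarith

lemma err_eq (f : ℝ → ℝ) (n : ℕ) (hn : 0 < n) (x : ℝ) (hx : x ∈ Set.Icc (-1:ℝ) 1)
    (h : ¬ isNode n x) :
    (berrut f n x - f x) * Dden n x =
      - ∑ k ∈ Finset.range (n+1), (-1:ℝ)^k * slope f x (node n k) := by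
  have hD : Dden n x ≠ 0 := by
    have := Dden_lower n hn x hx h
    have h2 : (0:ℝ) < n := by positivity
    intro h0; rw [h0, abs_zero] at this; linarith
  rw [berrut, if_neg h, sub_mul, div_mul_cancel₀ _ hD, Nnum, Dden, Finset.mul_sum,
    ← Finset.sum_sub_distrib, ← Finset.sum_neg_distrib]
  apply Finset.sum_congr rfl
  intro k hk
  have hk : k ≤ n := by simpa [Nat.lt_succ_iff] using hk
  have hne : x - node n k ≠ 0 := fun h0 => h ⟨k, hk, by linarith⟩
  have hne' : node n k - x ≠ 0 := fun h0 => h ⟨k, hk, by linarith⟩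
  rw [slope_def_field]
  field_simp
  ring

lemma alt_sum (j : ℕ) : ∑ k ∈ Finset.range (2 * j + 1 + 1), (-1:ℝ)^k = 0 := by
  have : 2 * j + 1 + 1 = 2 * (j+1) := by ring
  rw [this]
  simp

lemma linear_case (f : ℝ → ℝ) (a b : ℝ) (hf : ∀ x ∈ Set.Icc (-1:ℝ) 1, f x = a + b * x) (j : ℕ)
    (x : ℝ) (hx : x ∈ Set.Icc (-1:ℝ) 1) : berrut f (2 * j + 1) x - f x = 0 := by
  by_cases h : isNode (2 * j + 1) x
  · simp [berrut, h]
  · have e := err_eq f (2*j+1) (by omega) x hx h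
    have hD := Dden_lower (2*j+1) (by omega) x hx h
    have h2 : (0:ℝ) < (2*j+1 : ℕ) := by positivity
    have hD0 : Dden (2*j+1) x ≠ 0 := by
      intro h0; rw [h0, abs_zero] at hD; linarith
    have : ∑ k ∈ Finset.range (2*j+1+1), (-1:ℝ)^k * slope f x (node (2*j+1) k) = 0 := by
      rw [← mul_zero b, ← alt_sum j, Finset.mul_sum]
      apply Finset.sum_congr rfl
      intro k hk
      have hk : k ≤ 2*j+1 := by simpa [Nat.lt_succ_iff] using hk
      have hne' : node (2*j+1) k - x ≠ 0 := fun h0 => h ⟨k, hk, by linarith⟩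
      rw [slope_def_field, hf x hx, hf _ (node_mem _ _ hk)]
      field_simp
      ring
    rw [this, neg_zero] at e
    exact (mul_eq_zero.1 e).resolve_right hD0

lemma err_bdd (f : ℝ → ℝ) (L : ℝ)
    (hL : ∀ x ∈ Set.Icc (-1:ℝ) 1, ∀ y ∈ Set.Icc (-1:ℝ) 1, |f y - f x| ≤ L * |y - x|)
    (n : ℕ) (hn : 0 < n) :
    BddAbove (Set.range fun x : Set.Icc (-1:ℝ) 1 => |berrut f n x - f x|) := by
  have hL0 : 0 ≤ L := by
    have := hL 0 (by simp) 1 (by simp)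
    have h2 := abs_nonneg (f 1 - f 0)
    norm_num at this; linarith
  have hn' : (0:ℝ) < n := by positivity
  refine ⟨((n+1) * L) / (n / 2), ?_⟩
  rintro _ ⟨⟨x, hx⟩, rfl⟩
  simp only
  by_cases h : isNode n x
  · simp [berrut, h]; positivity
  · have e := err_eq f n hn x hx h
    have hD := Dden_lower n hn x hx h
    rw [le_div_iff₀ (by positivity)]
    calc |berrut f n x - f x| * (n/2) ≤ |berrut f n x - f x| * |Dden n x| := by gcongr
      _ = |∑ k ∈ Finset.range (n+1), (-1:ℝ)^k * slope f x (node n k)| := by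
        rw [← abs_mul, e, abs_neg]
      _ ≤ ∑ k ∈ Finset.range (n+1), |(-1:ℝ)^k * slope f x (node n k)| :=
        Finset.abs_sum_le_sum_abs _ _
      _ ≤ ∑ k ∈ Finset.range (n+1), L := by
        apply Finset.sum_le_sum
        intro k hk
        have hk : k ≤ n := by simpa [Nat.lt_succ_iff] using hk
        have hne' : node n k - x ≠ 0 := fun h0 => h ⟨k, hk, by linarith⟩
        rw [abs_mul, abs_pow, abs_neg, abs_one, one_pow, one_mul, slope_def_field, abs_div,
          div_le_iff₀ (abs_pos.2 hne')]
        exact hL x hx _ (node_mem n k hk)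
      _ = (n+1) * L := by simp

lemma node_succ (n k : ℕ) : node n (k+1) = node n k + 2 / n := by
  unfold node; push_cast; ring

lemma node_mono (n k : ℕ) : node n k ≤ node n (k+1) := by
  rw [node_succ]; have : (0:ℝ) ≤ 2 / n := by positivity
  linarith

lemma osc_cont (c : ℝ → ℝ) (hc : Continuous c) (hs : HasCompactSupport c) :
    Tendsto (fun j : ℕ => ∑ k ∈ Finset.range (2*j+1), (-1:ℝ)^k *
      ∫ t in node (2*j+1) k..node (2*j+1) (k+1), c t) atTop (nhds 0) := by
  obtain ⟨M, hM⟩ := hs.exists_bound_of_continuous hc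
  have huc : UniformContinuous c := hs.uniformContinuous_of_continuous hc
  have hh : Tendsto (fun j : ℕ => (2:ℝ) / ((2*j+1 : ℕ) : ℝ)) atTop (nhds 0) := by
    apply Tendsto.const_div_atTop
    apply tendsto_natCast_atTop_atTop.comp
    exact tendsto_atTop_mono (fun j => by simp only [id]; omega) tendsto_id
  rw [Metric.tendsto_atTop]
  intro ε hε
  obtain ⟨δ, hδ, hδ'⟩ := Metric.uniformContinuous_iff.1 huc (ε/2) (by positivity)
  have hhM : Tendsto (fun j : ℕ => (2:ℝ) / ((2*j+1 : ℕ) : ℝ) * M) atTop (nhds 0) := by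
    simpa using hh.mul_const M
  have ev1 := hh.eventually (gt_mem_nhds hδ)
  have ev2 := hhM.eventually (gt_mem_nhds (show 0 < ε/2 by positivity))
  obtain ⟨J, hJ⟩ := eventually_atTop.1 (ev1.and ev2)
  refine ⟨J, fun j hj => ?_⟩
  obtain ⟨h1, h2⟩ := hJ j hj
  set n := 2 * j + 1 with hn
  set h : ℝ := 2 / (n:ℝ) with hh'
  have hn0 : (0:ℝ) < n := by positivity
  have hpos : 0 < h := by positivity
  have pair : ∀ m : ℕ, ∑ k ∈ Finset.range (2*m), (-1:ℝ)^k * ∫ t in node n k..node n (k+1), c t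
      = ∑ i ∈ Finset.range m, ∫ t in node n (2*i)..node n (2*i+1), (c t - c (t + h)) := by
    intro m
    induction m with
    | zero => simp
    | succ m ih =>
      rw [show 2 * (m+1) = 2*m+1+1 by ring, Finset.sum_range_succ, Finset.sum_range_succ,
        Finset.sum_range_succ, ih, add_assoc]
      congr 1
      rw [intervalIntegral.integral_sub (hc.intervalIntegrable _ _)
        ((by fun_prop : Continuous fun t => c (t+h)).intervalIntegrable _ _),
        intervalIntegral.integral_comp_add_right (fun t => c t) h, ← node_succ, ← node_succ]
      simp [pow_succ]
      ring
  rw [dist_zero_right, hn, Finset.sum_range_succ, ← hn, pair]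
  have b1 : ‖∑ i ∈ Finset.range j, ∫ t in node n (2*i)..node n (2*i+1), (c t - c (t + h))‖
      ≤ ∑ i ∈ Finset.range j, (ε/2) * h := by
    apply norm_sum_le_of_le
    intro i _
    have := intervalIntegral.norm_integral_le_of_norm_le_const (a := node n (2*i))
      (b := node n (2*i+1)) (f := fun t => c t - c (t+h)) (C := ε/2) (by
        intro t _
        have := hδ' (a := t) (b := t+h) (by simp [Real.dist_eq, abs_of_pos hpos, h1])
        rw [dist_eq_norm] at this
        exact this.le)
    rw [node_succ, add_sub_cancel_left, abs_of_pos hpos] at this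
    rw [node_succ]; exact this
  have b2 : ‖(-1:ℝ)^(2*j) * ∫ t in node n (2*j)..node n (2*j+1), c t‖ ≤ M * h := by
    rw [norm_mul, norm_pow, norm_neg, norm_one, one_pow, one_mul]
    have := intervalIntegral.norm_integral_le_of_norm_le_const (a := node n (2*j))
      (b := node n (2*j+1)) (f := c) (C := M) (fun t _ => hM t)
    rw [node_succ, add_sub_cancel_left, abs_of_pos hpos] at this
    rw [node_succ]; exact this
  have b3 : (j:ℝ) * h ≤ 1 := by
    rw [hh', mul_div_assoc', div_le_one hn0, hn]; push_cast; linarith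
  simp only [Finset.sum_const, Finset.card_range, nsmul_eq_mul] at b1
  calc _ ≤ _ := norm_add_le _ _
    _ ≤ j * (ε/2*h) + M * h := add_le_add b1 b2
    _ < ε := by nlinarith

lemma osc_bound (n : ℕ) (hn : 0 < n) (ψ : ℝ → ℝ) (hψ : Integrable ψ volume) :
    |∑ k ∈ Finset.range n, (-1:ℝ)^k * ∫ t in node n k..node n (k+1), ψ t| ≤ ∫ t, ‖ψ t‖ := by
  calc _ ≤ ∑ k ∈ Finset.range n, ∫ t in node n k..node n (k+1), ‖ψ t‖ := by
        refine (Finset.abs_sum_le_sum_abs _ _).trans (Finset.sum_le_sum fun k _ => ?_)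
        rw [abs_mul, abs_pow, abs_neg, abs_one, one_pow, one_mul, ← Real.norm_eq_abs]
        exact intervalIntegral.norm_integral_le_integral_norm (node_mono n k)
    _ = ∫ t in node n 0..node n n, ‖ψ t‖ := by
        exact intervalIntegral.sum_integral_adjacent_intervals (a := node n) (μ := volume)
          (f := fun t => ‖ψ t‖) (n := n) fun k _ => hψ.norm.intervalIntegrable
    _ ≤ _ := by
        rw [intervalIntegral.integral_of_le]
        · exact setIntegral_le_integral hψ.norm (Eventually.of_forall fun t => norm_nonneg _)
        · have : (n:ℝ) ≠ 0 := by positivity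
          simp only [node]; field_simp; norm_num

lemma osc_int (ψ : ℝ → ℝ) (hψ : Integrable ψ volume) :
    Tendsto (fun j : ℕ => ∑ k ∈ Finset.range (2*j+1), (-1:ℝ)^k *
      ∫ t in node (2*j+1) k..node (2*j+1) (k+1), ψ t) atTop (nhds 0) := by
  rw [Metric.tendsto_atTop]
  intro ε hε
  obtain ⟨c, hs, hle, hc, hci⟩ := hψ.exists_hasCompactSupport_integral_sub_le
    (show 0 < ε/2 by positivity)
  obtain ⟨J, hJ⟩ := Metric.tendsto_atTop.1 (osc_cont c hc hs) (ε/2) (by positivity)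
  refine ⟨J, fun j hj => ?_⟩
  have h1 := hJ j hj
  have h2 := (osc_bound (2*j+1) (by omega) _ (hψ.sub hci))
  rw [dist_zero_right, Real.norm_eq_abs] at h1 ⊢
  have h3 : ∑ k ∈ Finset.range (2*j+1), (-1:ℝ)^k *
      ∫ t in node (2*j+1) k..node (2*j+1) (k+1), ψ t =
      ∑ k ∈ Finset.range (2*j+1), (-1:ℝ)^k *
      (∫ t in node (2*j+1) k..node (2*j+1) (k+1), (ψ - c) t) +
      ∑ k ∈ Finset.range (2*j+1), (-1:ℝ)^k *
      ∫ t in node (2*j+1) k..node (2*j+1) (k+1), c t := by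
    rw [← Finset.sum_add_distrib]
    apply Finset.sum_congr rfl
    intro k _
    simp only [Pi.sub_apply]
    rw [intervalIntegral.integral_sub hψ.intervalIntegrable hci.intervalIntegrable]
    ring
  rw [h3]
  have h4 : ∫ t, ‖(ψ - c) t‖ ≤ ε/2 := hle
  calc _ ≤ _ := abs_add_le _ _
    _ < ε := by linarith

/-- The oscillation sum tends to zero for slopes of functions with monotone derivative. -/
lemma osc_mono (f f' : ℝ → ℝ)
    (hf : ∀ x ∈ Set.Icc (-1 : ℝ) 1, HasDerivWithinAt f (f' x) (Set.Icc (-1 : ℝ) 1) x)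
    (hm : MonotoneOn f' (Set.Icc (-1:ℝ) 1)) (x : ℝ) (hx : x ∈ Set.Ioo (-1:ℝ) 1) :
    Tendsto (fun j : ℕ => ∑ k ∈ Finset.range (2*j+1), (-1:ℝ)^k *
      (dslope f x (node (2*j+1) (k+1)) - dslope f x (node (2*j+1) k))) atTop (nhds 0) := by
  have hd : ∀ t ∈ Set.Ioo (-1:ℝ) 1, HasDerivAt f (f' t) t := fun t ht =>
    (hf t (Ioo_subset_Icc_self ht)).hasDerivAt (Icc_mem_nhds ht.1 ht.2)
  have hfc : ContinuousOn f (Icc (-1) 1) := fun t ht => (hf t ht).continuousWithinAt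
  have hφc : ContinuousOn (dslope f x) (Icc (-1) 1) :=
    (continuousOn_dslope (Icc_mem_nhds hx.1 hx.2)).2 ⟨hfc, (hd x hx).differentiableAt⟩
  set φ' : ℝ → ℝ := fun t => (f' t * (t - x) - (f t - f x)) / (t - x)^2 with hφ'
  have hφd : ∀ t ∈ Ioo (-1:ℝ) 1, t ≠ x → HasDerivAt (dslope f x) (φ' t) t := by
    intro t ht hne
    have h1 : HasDerivAt (fun t => (f t - f x) / (t - x)) (φ' t) t := by
      have := ((hd t ht).sub_const (f x)).fun_div ((hasDerivAt_id t).sub_const x)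
        (sub_ne_zero.2 hne)
      simpa [hφ'] using this
    apply h1.congr_of_eventuallyEq
    filter_upwards [isOpen_ne.mem_nhds hne] with s hs
    rw [dslope_of_ne _ hs, slope_def_field]
  have hpos : ∀ t ∈ Ioo (-1:ℝ) 1, t ≠ x → 0 ≤ φ' t := by
    intro t ht hne
    apply div_nonneg _ (sq_nonneg _)
    rcases lt_or_gt_of_ne hne with h | h
    · obtain ⟨c, hc, hc'⟩ := exists_hasDerivAt_eq_slope f f' h
        (hfc.mono (Icc_subset_Icc ht.1.le hx.2.le))
        (fun s hs => hd s ⟨ht.1.trans hs.1, hs.2.trans hx.2⟩)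
      have := hm (Ioo_subset_Icc_self ht) ⟨(ht.1.trans hc.1).le, (hc.2.trans hx.2).le⟩ hc.1.le
      rw [eq_div_iff (by linarith)] at hc'
      nlinarith
    · obtain ⟨c, hc, hc'⟩ := exists_hasDerivAt_eq_slope f f' h
        (hfc.mono (Icc_subset_Icc hx.1.le ht.2.le))
        (fun s hs => hd s ⟨hx.1.trans hs.1, hs.2.trans ht.2⟩)
      have := hm ⟨(hx.1.trans hc.1).le, (hc.2.trans ht.2).le⟩ (Ioo_subset_Icc_self ht) hc.2.le
      rw [eq_div_iff (by linarith)] at hc'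
      nlinarith
  have i1 : IntegrableOn φ' (Ioc (-1) x) :=
    intervalIntegral.integrableOn_deriv_of_nonneg (hφc.mono (Icc_subset_Icc le_rfl hx.2.le))
      (fun t ht => hφd t ⟨ht.1, ht.2.trans hx.2⟩ ht.2.ne)
      (fun t ht => hpos t ⟨ht.1, ht.2.trans hx.2⟩ ht.2.ne)
  have i2 : IntegrableOn φ' (Ioc x 1) :=
    intervalIntegral.integrableOn_deriv_of_nonneg (hφc.mono (Icc_subset_Icc hx.1.le le_rfl))
      (fun t ht => hφd t ⟨hx.1.trans ht.1, ht.2⟩ ht.1.ne')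
      (fun t ht => hpos t ⟨hx.1.trans ht.1, ht.2⟩ ht.1.ne')
  have i3 : IntegrableOn φ' (Ioc (-1) 1) := by
    rw [← Ioc_union_Ioc_eq_Ioc hx.1.le hx.2.le]; exact i1.union i2
  have i4 : Integrable (indicator (Ioc (-1) 1) φ') volume :=
    (integrable_indicator_iff measurableSet_Ioc).2 i3
  refine (osc_int _ i4).congr fun j => ?_
  apply Finset.sum_congr rfl
  intro k hk
  have hk : k < 2*j+1 := Finset.mem_range.1 hk
  have m1 := node_mem (2*j+1) k hk.le
  have m2 := node_mem (2*j+1) (k+1) hk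
  have le := node_mono (2*j+1) k
  congr 1
  apply integral_eq_of_hasDerivAt_off_countable_of_le _ _ le (countable_singleton x)
    (hφc.mono (Icc_subset_Icc m1.1 m2.2)) _ i4.intervalIntegrable
  intro t ht
  have ht' : t ∈ Ioo (-1:ℝ) 1 := ⟨m1.1.trans_lt ht.1.1, ht.1.2.trans_le m2.2⟩
  rw [indicator_of_mem (Ioo_subset_Ioc_self ht')]
  exact hφd t ht' ht.2

lemma osc_AC1 (f : ℝ → ℝ) (hf : AC1 f) (x : ℝ) (hx : x ∈ Set.Ioo (-1:ℝ) 1) :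
    Tendsto (fun j : ℕ => ∑ k ∈ Finset.range (2*j+1), (-1:ℝ)^k *
      (dslope f x (node (2*j+1) (k+1)) - dslope f x (node (2*j+1) k))) atTop (nhds 0) := by
  obtain ⟨f', hd, g, hg, hfg⟩ := hf
  set G : ℝ → ℝ := fun t => ∫ s in (-1:ℝ)..t, |g s| with hG
  have hsub : ∀ a ∈ Icc (-1:ℝ) 1, ∀ b ∈ Icc (-1:ℝ) 1, IntervalIntegrable g volume a b := by
    intro a ha b hb
    apply hg.mono_set
    rw [uIcc_of_le (show (-1:ℝ) ≤ 1 by norm_num)]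
    exact uIcc_subset_Icc ha hb
  have m1 : (-1:ℝ) ∈ Icc (-1:ℝ) 1 := by simp
  have hGc : ContinuousOn G (Icc (-1) 1) := by
    have := intervalIntegral.continuousOn_primitive_interval' (a := -1) hg.abs (by simp)
    rwa [uIcc_of_le (show (-1:ℝ) ≤ 1 by norm_num)] at this
  have hGd : ∀ a ∈ Icc (-1:ℝ) 1, ∀ b ∈ Icc (-1:ℝ) 1, a ≤ b → |f' b - f' a| ≤ G b - G a := by
    intro a ha b hb hab
    rw [hfg a ha, hfg b hb, hG]
    simp only
    rw [add_sub_add_left_eq_sub, intervalIntegral.integral_interval_sub_left (hsub _ m1 _ hb) (hsub _ m1 _ ha),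
      intervalIntegral.integral_interval_sub_left (hsub _ m1 _ hb).abs (hsub _ m1 _ ha).abs]
    exact intervalIntegral.abs_integral_le_integral_abs hab
  set F : ℝ → ℝ := fun t => ∫ s in (-1:ℝ)..t, G s with hF
  have hFd : ∀ t ∈ Icc (-1:ℝ) 1, HasDerivWithinAt F (G t) (Icc (-1) 1) t := by
    intro t ht
    haveI := Fact.mk ht
    apply intervalIntegral.integral_hasDerivWithinAt_right
    · exact (hGc.mono (Icc_subset_Icc le_rfl ht.2)).intervalIntegrable_of_Icc ht.1
    · exact hGc.stronglyMeasurableAtFilter_nhdsWithin measurableSet_Icc t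
    · exact hGc t ht
  have t1 := osc_mono F G hFd (fun a ha b hb hab => by
    have := hGd a ha b hb hab; linarith [abs_nonneg (f' b - f' a)]) x hx
  have t2 := osc_mono (fun t => f t + F t) (fun t => f' t + G t)
    (fun t ht => (hd t ht).add (hFd t ht)) (fun a ha b hb hab => by
      have := hGd a ha b hb hab
      have := (abs_le.1 this).1
      simp only; linarith) x hx
  have hnb : Icc (-1:ℝ) 1 ∈ nhds x := Icc_mem_nhds hx.1 hx.2
  have hxI := Ioo_subset_Icc_self hx
  have e : ∀ t, dslope f x t = dslope (fun t => f t + F t) x t - dslope F x t := by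
    intro t
    by_cases h : t = x
    · subst h
      rw [dslope_same, dslope_same, dslope_same, ((hd t hxI).hasDerivAt hnb).deriv,
        ((hFd t hxI).hasDerivAt hnb).deriv,
        (((hd t hxI).hasDerivAt hnb).fun_add ((hFd t hxI).hasDerivAt hnb)).deriv]
      ring
    · rw [dslope_of_ne _ h, dslope_of_ne _ h, dslope_of_ne _ h, slope_def_field, slope_def_field,
        slope_def_field]
      ring
  have t3 := t2.sub t1
  rw [sub_zero] at t3
  refine t3.congr fun j => ?_
  rw [← Finset.sum_sub_distrib]
  apply Finset.sum_congr rfl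
  intro k _
  rw [e, e]; ring

lemma sum_tele (n : ℕ) (u : ℕ → ℝ) : ∑ k ∈ Finset.range n, (-1:ℝ)^k * (u (k+1) - u k) =
    -2 * ∑ k ∈ Finset.range (n+1), (-1:ℝ)^k * u k + u 0 + (-1)^n * u n := by
  induction n with
  | zero => simp; ring
  | succ n ih => rw [Finset.sum_range_succ, ih, Finset.sum_range_succ _ (n+1)]; ring

lemma AC1_lip (f : ℝ → ℝ) (hf : AC1 f) : ∃ L : ℝ,
    ∀ x ∈ Set.Icc (-1:ℝ) 1, ∀ y ∈ Set.Icc (-1:ℝ) 1, |f y - f x| ≤ L * |y - x| := by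
  obtain ⟨f', hd, g, hg, hfg⟩ := hf
  have hc : ContinuousOn f' (Icc (-1) 1) := by
    have := intervalIntegral.continuousOn_primitive_interval' (a := -1) hg (by simp)
    rw [uIcc_of_le (show (-1:ℝ) ≤ 1 by norm_num)] at this
    exact (continuousOn_const.add this).congr hfg
  obtain ⟨L, hL⟩ := isCompact_Icc.exists_bound_of_continuousOn hc
  exact ⟨L, fun x hx y hy =>
    Convex.norm_image_sub_le_of_norm_hasDerivWithin_le hd hL (convex_Icc _ _) hx hy⟩

lemma key_point (f : ℝ → ℝ) (hf : AC1 f)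
    (h : Tendsto
      (fun j : ℕ => ((2 * j + 1 : ℕ) : ℝ) *
        ⨆ x : Set.Icc (-1 : ℝ) 1, |berrut f (2 * j + 1) (x : ℝ) - f (x : ℝ)|)
      atTop (nhds 0)) (p q : ℕ) (hp : Odd p) (hq : Even q) (hpq : p < q) (x : ℝ)
    (hxe : x = 2 * p / q - 1) :
    f x = (f 1 + f (-1)) / 2 + ((f 1 - f (-1)) / 2) * x := by
  have hp0 : (0:ℝ) < p := by exact_mod_cast hp.pos
  have hpq' : (p:ℝ) < q := by exact_mod_cast hpq
  have hq0 : (0:ℝ) < q := by linarith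
  have hx : x ∈ Ioo (-1:ℝ) 1 := by
    have : 0 < 2 * p / (q:ℝ) := by positivity
    have h2 : 2 * p / (q:ℝ) < 2 := by rw [div_lt_iff₀ hq0]; linarith
    rw [hxe]; constructor <;> linarith
  have hxI := Ioo_subset_Icc_self hx
  obtain ⟨L, hL⟩ := AC1_lip f hf
  have hS : Tendsto (fun j : ℕ => ∑ k ∈ Finset.range (2*j+1+1), (-1:ℝ)^k *
      dslope f x (node (2*j+1) k)) atTop (nhds 0) := by
    have h' := h.mul_const (q:ℝ)
    rw [zero_mul] at h'
    apply squeeze_zero_norm _ h'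
    intro j
    obtain ⟨hno, hD⟩ := Dden_upper (2*j+1) p q ⟨j, rfl⟩ hp hq hpq
    rw [← hxe] at hno hD
    have e := err_eq f (2*j+1) (by omega) x hxI hno
    have e2 : ∑ k ∈ Finset.range (2*j+1+1), (-1:ℝ)^k * dslope f x (node (2*j+1) k) =
        - ((berrut f (2*j+1) x - f x) * Dden (2*j+1) x) := by
      rw [e, neg_neg]
      apply Finset.sum_congr rfl
      intro k hk
      rw [dslope_of_ne]
      intro h0
      exact hno ⟨k, by simpa [Nat.lt_succ_iff] using hk, h0.symm⟩
    rw [e2, norm_neg, norm_mul, Real.norm_eq_abs, Real.norm_eq_abs]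
    have hsup := le_ciSup (err_bdd f L hL (2*j+1) (by omega)) ⟨x, hxI⟩
    simp only at hsup
    calc _ ≤ (⨆ x : Set.Icc (-1 : ℝ) 1, |berrut f (2 * j + 1) (x : ℝ) - f (x : ℝ)|) *
          (((2*j+1 : ℕ) : ℝ) * q) :=
          mul_le_mul hsup hD (abs_nonneg _) ((abs_nonneg _).trans hsup)
      _ = _ := by ring
  have hT := osc_AC1 f hf x hx
  have hT2 : Tendsto (fun j : ℕ => ∑ k ∈ Finset.range (2*j+1), (-1:ℝ)^k *
      (dslope f x (node (2*j+1) (k+1)) - dslope f x (node (2*j+1) k))) atTop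
      (nhds (-2 * 0 + (dslope f x (-1) - dslope f x 1))) := by
    refine ((hS.const_mul (-2)).add_const _).congr fun j => ?_
    rw [sum_tele (2*j+1) (fun k => dslope f x (node (2*j+1) k))]
    have n0 : node (2*j+1) 0 = -1 := by simp [node]
    have n1 : node (2*j+1) (2*j+1) = 1 := by
      have : ((2*j+1 : ℕ):ℝ) ≠ 0 := by positivity
      unfold node; field_simp; norm_num
    rw [n0, n1, pow_succ, pow_mul]; norm_num; ring
  have := tendsto_nhds_unique hT hT2
  rw [dslope_of_ne _ hx.1.ne, dslope_of_ne _ hx.2.ne', slope_def_field, slope_def_field] at this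
  have h1 : (-1:ℝ) - x ≠ 0 := by linarith [hx.1]
  have h2 : 1 - x ≠ 0 := by linarith [hx.2]
  field_simp at this
  linarith

lemma exists_dyadic (x : ℝ) (hx : x ∈ Ioo (-1:ℝ) 1) (δ : ℝ) (hδ : 0 < δ) :
    ∃ p q : ℕ, Odd p ∧ Even q ∧ p < q ∧ |(2 * p / q - 1 : ℝ) - x| < δ := by
  obtain ⟨m, hm⟩ := exists_nat_gt (max (1/δ) (1 / (1 - x)))
  have hd1 : 1/δ < m := (le_max_left _ _).trans_lt hm
  have hd2 : 1/(1-x) < m := (le_max_right _ _).trans_lt hm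
  have hx1 : 0 < 1 - x := by linarith [hx.2]
  have hx2 : 0 < 1 + x := by linarith [hx.1]
  have hm0 : (0:ℝ) < m := lt_trans (by positivity) hd1
  rw [div_lt_iff₀ hδ] at hd1
  rw [div_lt_iff₀ hx1] at hd2
  have hy : 0 ≤ m * (1+x) / 2 := by positivity
  have f1 := Nat.floor_le hy
  have f2 := Nat.lt_floor_add_one (m * (1+x)/2)
  set r := ⌊m * (1+x)/2⌋₊
  refine ⟨2 * r + 1, 2 * m, ⟨r, rfl⟩, even_two_mul m, ?_, ?_⟩
  · have : (r:ℝ) < m := by nlinarith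
    have : r < m := by exact_mod_cast this
    omega
  · push_cast
    have : 2 * (2 * (r:ℝ) + 1) / (2 * m) - 1 - x = (2 * r + 1 - m * (1+x)) / m := by
      field_simp; ring
    rw [this, abs_div, abs_of_pos hm0, div_lt_iff₀ hm0]
    refine lt_of_le_of_lt ?_ (by linarith : (1:ℝ) < δ * m)
    rw [abs_le]; constructor <;> linarith

/-- for `f ∈ AC¹`, `n ‖B_n f - f‖_∞ → 0` along odd `n` iff `f` is linear. -/
theorem statement1 (f : ℝ → ℝ) (hf : AC1 f) :
    Filter.Tendsto
      (fun j : ℕ => ((2 * j + 1 : ℕ) : ℝ) *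
        ⨆ x : Set.Icc (-1 : ℝ) 1, |berrut f (2 * j + 1) (x : ℝ) - f (x : ℝ)|)
      Filter.atTop (nhds 0) ↔
    ∀ x ∈ Set.Icc (-1 : ℝ) 1,
      f x = (f 1 + f (-1)) / 2 + ((f 1 - f (-1)) / 2) * x := by
  constructor
  · intro h
    obtain ⟨L, hL⟩ := AC1_lip f hf
    intro x hx
    rcases eq_or_lt_of_le hx.1 with h1 | h1
    · rw [← h1]; ring
    rcases eq_or_lt_of_le hx.2 with h2 | h2
    · rw [h2]; ring
    by_contra hne
    set b := (f 1 - f (-1)) / 2 with hb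
    set a := (f 1 + f (-1)) / 2 with ha
    have hpos : 0 < |f x - (a + b * x)| := abs_pos.2 (sub_ne_zero.2 hne)
    have hC : 0 < |L| + |b| + 1 := by positivity
    obtain ⟨p, q, hp, hq, hpq, hd⟩ := exists_dyadic x ⟨h1, h2⟩
      (|f x - (a + b * x)| / (|L| + |b| + 1)) (by positivity)
    have hk := key_point f hf h p q hp hq hpq _ rfl
    have hm : (2 * p / q - 1 : ℝ) ∈ Set.Icc (-1:ℝ) 1 := node_mem q p hpq.le
    set u : ℝ := 2 * p / q - 1 with hu
    rw [lt_div_iff₀ hC] at hd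
    have e : f x - (a + b * x) = -(f u - f x) + b * (u - x) := by rw [hk]; ring
    have h3 := hL x hx u hm
    have h4 : |f x - (a + b * x)| ≤ |f u - f x| + |b| * |u - x| := by
      rw [e, ← abs_mul, ← abs_neg (f u - f x)]; exact abs_add_le _ _
    have h5 : L * |u - x| ≤ |L| * |u - x| := by
      gcongr; exact le_abs_self L
    nlinarith [abs_nonneg (u - x)]
  · intro h
    have : ∀ j : ℕ, ((2 * j + 1 : ℕ) : ℝ) *
        (⨆ x : Set.Icc (-1 : ℝ) 1, |berrut f (2 * j + 1) (x : ℝ) - f (x : ℝ)|) = 0 := by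
      intro j
      have h0 : ∀ x : Set.Icc (-1 : ℝ) 1, |berrut f (2 * j + 1) (x : ℝ) - f (x : ℝ)| = 0 := by
        rintro ⟨x, hx⟩
        rw [abs_eq_zero]
        exact linear_case f _ _ h j x hx
      simp [h0]
    simp only [this]
    exact tendsto_const_nhds
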